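/- Second-difference consistency of the auxiliary interpolants in the flow direction: let u=(u^x,u^y) ∈ L^∞([0,T];W^{4,∞}(Ω))², and define ε^{x,x,n}_{i+1/2,j+1/2} = (h_{i+1/2}²/24)·∂³u^x/∂x³(x_{i+1/2},y_{j+1/2},t^n) − (k_{j+1/2}²/8)·∂³u^x/∂x∂y²(x_{i+1/2},y_{j+1/2},t^n) and ε^{y,y,n}_{i+1/2,j+1/2} = −(h_{i+1/2}²/8)·∂³u^y/∂x²∂y(x_{i+1/2},y_{j+1/2},t^n) + (k_{j+1/2}²/24)·∂³u^y/∂y³(x_{i+1/2},y_{j+1/2},t^n). Then there exists a constant C depending only on Ω such that for all n and interior indices: |(d_xũ^{x,n}_{i+1/2,j+1/2}−d_xũ^{x,n}_{i-1/2,j+1/2})/h_i − (1/h_i)∫_{x_{i-1/2}}^{x_{i+1/2}} ∂²u^x/∂x²(x,y_{j+1/2},t^n)dx − (ε^{x,x,n}_{i+1/2,j+1/2}−ε^{x,x,n}_{i-1/2,j+1/2})/h_i| ≤ C‖u‖_{L^∞([0,T];W^{4,∞}(Ω))}(h²+k²), and symmetrically |(d_yũ^{y,n}_{i+1/2,j+1/2}−d_yũ^{y,n}_{i+1/2,j-1/2})/k_j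 − (1/k_j)∫_{y_{j-1/2}}^{y_{j+1/2}} ∂²u^y/∂y²(x_{i+1/2},y,t^n)dy − (ε^{y,y,n}_{i+1/2,j+1/2}−ε^{y,y,n}_{i+1/2,j-1/2})/k_j| ≤ C‖u‖_{L^∞([0,T];W^{4,∞}(Ω))}(h²+k²). -/

import Mathlib

open Finset MeasureTheory Real

noncomputable section

namespace RMAC

/-! ### Continuous-level notions -/

/-- Partial derivative in the first (x) variable of a function of (x, y, t). -/
def pdx (f : ℝ → ℝ → ℝ → ℝ) : ℝ → ℝ → ℝ → ℝ := fun x y t => deriv (fun s => f s y t) x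

/-- Partial derivative in the second (y) variable. -/
def pdy (f : ℝ → ℝ → ℝ → ℝ) : ℝ → ℝ → ℝ → ℝ := fun x y t => deriv (fun s => f x s t) y

/-- Partial derivative in the third (t) variable. -/
def pdt (f : ℝ → ℝ → ℝ → ℝ) : ℝ → ℝ → ℝ → ℝ := fun x y t => deriv (fun s => f x y s) t

/-- Infinitely differentiable function of (x, y, t). -/
def Smooth (f : ℝ → ℝ → ℝ → ℝ) : Prop :=
  ∀ n : ℕ, ContDiff ℝ n (fun q : ℝ × ℝ × ℝ => f q.1 q.2.1 q.2.2)

/-- `SobBound a b f Lx Ly T M` : all derivatives `∂_t^{a'} ∂_x^{b'} ∂_y^{c'} f` with `a' ≤ a`,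
`b' + c' ≤ b` are bounded by `M` on `[0,Lx] × [0,Ly] × [0,T]`; this encodes
`‖f‖_{W^{a,∞}([0,T];W^{b,∞}(Ω))} ≤ M`. -/
def SobBound (a b : ℕ) (f : ℝ → ℝ → ℝ → ℝ) (Lx Ly T M : ℝ) : Prop :=
  ∀ a' b' c' : ℕ, a' ≤ a → b' + c' ≤ b →
    ∀ x y t : ℝ, x ∈ Set.Icc 0 Lx → y ∈ Set.Icc 0 Ly → t ∈ Set.Icc 0 T →
      |(pdt^[a'] (pdx^[b'] (pdy^[c'] f))) x y t| ≤ M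

/-- The time-dependent Stokes problem on `Ω = (0,Lx) × (0,Ly)`, `t ∈ (0,T]`, with
viscosity `μ`, source `(gx, gy)`, homogeneous Dirichlet boundary condition and
homogeneous initial condition. -/
def IsStokesSol (μ Lx Ly T : ℝ) (ux uy p gx gy : ℝ → ℝ → ℝ → ℝ) : Prop :=
  (∀ x y t : ℝ, x ∈ Set.Ioo 0 Lx → y ∈ Set.Ioo 0 Ly → t ∈ Set.Ioc 0 T →
      pdt ux x y t - μ * (pdx (pdx ux) x y t + pdy (pdy ux) x y t) + pdx p x y t = gx x y t ∧
      pdt uy x y t - μ * (pdx (pdx uy) x y t + pdy (pdy uy) x y t) + pdy p x y t = gy x y t ∧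
      pdx ux x y t + pdy uy x y t = 0) ∧
  (∀ x y t : ℝ, x ∈ Set.Icc 0 Lx → y ∈ Set.Icc 0 Ly → t ∈ Set.Ioc 0 T →
      (x = 0 ∨ x = Lx ∨ y = 0 ∨ y = Ly) → ux x y t = 0 ∧ uy x y t = 0) ∧
  (∀ x y : ℝ, x ∈ Set.Icc 0 Lx → y ∈ Set.Icc 0 Ly → ux x y 0 = 0 ∧ uy x y 0 = 0)

/-- Divergence-free velocity field on `Ω` for all times in `[0,T]`. -/
def DivFree (Lx Ly T : ℝ) (ux uy : ℝ → ℝ → ℝ → ℝ) : Prop :=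
  ∀ x y t : ℝ, x ∈ Set.Ioo 0 Lx → y ∈ Set.Ioo 0 Ly → t ∈ Set.Icc 0 T →
    pdx ux x y t + pdy uy x y t = 0

/-- Homogeneous velocity boundary values on `∂Ω` for all times in `[0,T]`. -/
def BoundaryZero (Lx Ly T : ℝ) (ux uy : ℝ → ℝ → ℝ → ℝ) : Prop :=
  ∀ x y t : ℝ, x ∈ Set.Icc 0 Lx → y ∈ Set.Icc 0 Ly → t ∈ Set.Icc 0 T →
    (x = 0 ∨ x = Lx ∨ y = 0 ∨ y = Ly) → ux x y t = 0 ∧ uy x y t = 0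

/-! ### The staggered (MAC) grid

Index conventions for grid functions `f : ℤ → ℤ → ℝ`:
* cell-centered functions: `f i j` is the value at `(x_{i+1/2}, y_{j+1/2})`;
* x-edge functions (like `u^x`): `f i j` is the value at `(x_i, y_{j+1/2})`,
  with `j = -1` and `j = Ny` the ghost values representing `(x_i, y_0)` and `(x_i, y_{Ny})`;
* y-edge functions (like `u^y`): `f i j` is the value at `(x_{i+1/2}, y_j)`,
  with `i = -1` and `i = Nx` the ghost values representing `(x_0, y_j)` and `(x_{Nx}, y_j)`;
* node functions: `f i j` is the value at `(x_i, y_j)`. -/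
structure Grid where
  Nx : ℕ
  Ny : ℕ
  Lx : ℝ
  Ly : ℝ
  xp : ℤ → ℝ
  yp : ℤ → ℝ
  one_le_Nx : 1 ≤ Nx
  one_le_Ny : 1 ≤ Ny
  xp_zero : xp 0 = 0
  xp_last : xp Nx = Lx
  yp_zero : yp 0 = 0
  yp_last : yp Ny = Ly
  xp_mono : ∀ i : ℤ, 0 ≤ i → i < Nx → xp i < xp (i + 1)
  yp_mono : ∀ j : ℤ, 0 ≤ j → j < Ny → yp j < yp (j + 1)

namespace Grid

variable (G : Grid)

/-- `h_{i+1/2} = x_{i+1} - x_i`. -/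
def hh (i : ℤ) : ℝ := G.xp (i + 1) - G.xp i

/-- `k_{j+1/2} = y_{j+1} - y_j`. -/
def kk (j : ℤ) : ℝ := G.yp (j + 1) - G.yp j

/-- `x_{i+1/2} = (x_i + x_{i+1})/2`. -/
def xh (i : ℤ) : ℝ := (G.xp i + G.xp (i + 1)) / 2

/-- `y_{j+1/2} = (y_j + y_{j+1})/2`. -/
def yh (j : ℤ) : ℝ := (G.yp j + G.yp (j + 1)) / 2

/-- `h_i = (h_{i-1/2} + h_{i+1/2})/2`, with `h_0 = h_{1/2}/2`, `h_{Nx} = h_{Nx-1/2}/2`. -/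
def hc (i : ℤ) : ℝ :=
  if i = 0 then G.hh 0 / 2
  else if i = (G.Nx : ℤ) then G.hh ((G.Nx : ℤ) - 1) / 2
  else (G.hh (i - 1) + G.hh i) / 2

/-- `k_j = (k_{j-1/2} + k_{j+1/2})/2`, with `k_0 = k_{1/2}/2`, `k_{Ny} = k_{Ny-1/2}/2`. -/
def kc (j : ℤ) : ℝ :=
  if j = 0 then G.kk 0 / 2
  else if j = (G.Ny : ℤ) then G.kk ((G.Ny : ℤ) - 1) / 2
  else (G.kk (j - 1) + G.kk j) / 2

/-- `h = max_i h_{i+1/2}`. -/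
def hmax : ℝ :=
  (Finset.Icc (0 : ℤ) ((G.Nx : ℤ) - 1)).sup'
    (Finset.nonempty_Icc.mpr (by have := G.one_le_Nx; omega)) G.hh

/-- `k = max_j k_{j+1/2}`. -/
def kmax : ℝ :=
  (Finset.Icc (0 : ℤ) ((G.Ny : ℤ) - 1)).sup'
    (Finset.nonempty_Icc.mpr (by have := G.one_le_Ny; omega)) G.kk

/-- Mesh regularity: `min_{i,j} {h_{i+1/2}, k_{j+1/2}} ≥ C₀ · max_{i,j} {h_{i+1/2}, k_{j+1/2}}`. -/
def Regular (C₀ : ℝ) : Prop :=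
  (∀ i : ℤ, 0 ≤ i → i < G.Nx → C₀ * G.hmax ≤ G.hh i ∧ C₀ * G.kmax ≤ G.hh i) ∧
  (∀ j : ℤ, 0 ≤ j → j < G.Ny → C₀ * G.hmax ≤ G.kk j ∧ C₀ * G.kmax ≤ G.kk j)

/-! ### Difference operators -/

/-- `d_x` of an x-edge function: value at the cell center `(x_{i+1/2}, y_{j+1/2})`. -/
def dxEx (f : ℤ → ℤ → ℝ) (i j : ℤ) : ℝ := (f (i + 1) j - f i j) / G.hh i

/-- `D_y` of an x-edge function: value at the node `(x_i, y_j)`. -/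
def DyEx (f : ℤ → ℤ → ℝ) (i j : ℤ) : ℝ := (f i j - f i (j - 1)) / G.kc j

/-- `d_y` of a y-edge function: value at the cell center `(x_{i+1/2}, y_{j+1/2})`. -/
def dyEy (f : ℤ → ℤ → ℝ) (i j : ℤ) : ℝ := (f i (j + 1) - f i j) / G.kk j

/-- `D_x` of a y-edge function: value at the node `(x_i, y_j)`. -/
def DxEy (f : ℤ → ℤ → ℝ) (i j : ℤ) : ℝ := (f i j - f (i - 1) j) / G.hc i

/-- `D_x` of a cell-centered function: value at the x-edge point `(x_i, y_{j+1/2})`. -/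
def DxC (q : ℤ → ℤ → ℝ) (i j : ℤ) : ℝ := (q i j - q (i - 1) j) / G.hc i

/-- `D_y` of a cell-centered function: value at the y-edge point `(x_{i+1/2}, y_j)`. -/
def DyC (q : ℤ → ℤ → ℝ) (i j : ℤ) : ℝ := (q i j - q i (j - 1)) / G.kc j

/-! ### Discrete inner products and norms -/

/-- `(f,g)_{l²,M}` over cell centers. -/
def ipM (f g : ℤ → ℤ → ℝ) : ℝ :=
  ∑ i ∈ Finset.Icc (0 : ℤ) ((G.Nx : ℤ) - 1), ∑ j ∈ Finset.Icc (0 : ℤ) ((G.Ny : ℤ) - 1),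
    G.hh i * G.kk j * f i j * g i j

/-- `(f,g)_{l²,T,M}` over x-edge points. -/
def ipTM (f g : ℤ → ℤ → ℝ) : ℝ :=
  ∑ i ∈ Finset.Icc (1 : ℤ) ((G.Nx : ℤ) - 1), ∑ j ∈ Finset.Icc (0 : ℤ) ((G.Ny : ℤ) - 1),
    G.hc i * G.kk j * f i j * g i j

/-- `(f,g)_{l²,M,T}` over y-edge points. -/
def ipMT (f g : ℤ → ℤ → ℝ) : ℝ :=
  ∑ i ∈ Finset.Icc (0 : ℤ) ((G.Nx : ℤ) - 1), ∑ j ∈ Finset.Icc (1 : ℤ) ((G.Ny : ℤ) - 1),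
    G.hh i * G.kc j * f i j * g i j

/-- `(f,g)_{l²,T_x}`. -/
def ipTx (f g : ℤ → ℤ → ℝ) : ℝ :=
  ∑ i ∈ Finset.Icc (0 : ℤ) (G.Nx : ℤ), ∑ j ∈ Finset.Icc (1 : ℤ) ((G.Ny : ℤ) - 1),
    G.hc i * G.kc j * f i j * g i j

/-- `(f,g)_{l²,T_y}`. -/
def ipTy (f g : ℤ → ℤ → ℝ) : ℝ :=
  ∑ i ∈ Finset.Icc (1 : ℤ) ((G.Nx : ℤ) - 1), ∑ j ∈ Finset.Icc (0 : ℤ) (G.Ny : ℤ),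
    G.hc i * G.kc j * f i j * g i j

/-- `‖v‖²_{l²} = ‖v^x‖²_{l²,T,M} + ‖v^y‖²_{l²,M,T}` for a discrete velocity. -/
def velNormSq (vx vy : ℤ → ℤ → ℝ) : ℝ := G.ipTM vx vx + G.ipMT vy vy

/-- `‖Dv‖²_{l²}` for a discrete velocity. -/
def DvelNormSq (vx vy : ℤ → ℤ → ℝ) : ℝ :=
  G.ipM (G.dxEx vx) (G.dxEx vx) + G.ipTy (G.DyEx vx) (G.DyEx vx) +
    G.ipTx (G.DxEy vy) (G.DxEy vy) + G.ipM (G.dyEy vy) (G.dyEy vy)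

/-! ### Right-hand side discretization and the RMAC scheme -/

/-- `f^{x,n}_{i,j+1/2} = (1/h_i) ∫_{x_{i-1/2}}^{x_{i+1/2}} g^x(x, y_{j+1/2}, t^n) dx`. -/
def avgFx (gx : ℝ → ℝ → ℝ → ℝ) (Δt : ℝ) : ℕ → ℤ → ℤ → ℝ := fun n i j =>
  (1 / G.hc i) * ∫ x in (G.xh (i - 1))..(G.xh i), gx x (G.yh j) ((n : ℝ) * Δt)

/-- `f^{y,n}_{i+1/2,j} = (1/k_j) ∫_{y_{j-1/2}}^{y_{j+1/2}} g^y(x_{i+1/2}, y, t^n) dy`. -/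
def avgFy (gy : ℝ → ℝ → ℝ → ℝ) (Δt : ℝ) : ℕ → ℤ → ℤ → ℝ := fun n i j =>
  (1 / G.kc j) * ∫ y in (G.yh (j - 1))..(G.yh j), gy (G.xh i) y ((n : ℝ) * Δt)

/-- The RMAC scheme for the time-dependent Stokes equations, with discrete right-hand
sides `fx`, `fy`: homogeneous discrete boundary and initial conditions, the two discrete
momentum equations and the discrete divergence-free constraint. -/
def IsRMAC (μ Δt : ℝ) (fx fy Wx Wy Z : ℕ → ℤ → ℤ → ℝ) : Prop :=
  (∀ n : ℕ, ∀ j : ℤ, Wx n 0 j = 0 ∧ Wx n (G.Nx : ℤ) j = 0) ∧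
  (∀ n : ℕ, ∀ i : ℤ, Wx n i (-1) = 0 ∧ Wx n i (G.Ny : ℤ) = 0) ∧
  (∀ n : ℕ, ∀ i : ℤ, Wy n i 0 = 0 ∧ Wy n i (G.Ny : ℤ) = 0) ∧
  (∀ n : ℕ, ∀ j : ℤ, Wy n (-1) j = 0 ∧ Wy n (G.Nx : ℤ) j = 0) ∧
  (∀ i j : ℤ, Wx 0 i j = 0 ∧ Wy 0 i j = 0) ∧
  (∀ n : ℕ, 1 ≤ n →
    ∀ i ∈ Finset.Icc (1 : ℤ) ((G.Nx : ℤ) - 1), ∀ j ∈ Finset.Icc (0 : ℤ) ((G.Ny : ℤ) - 1),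
      (Wx n i j - Wx (n - 1) i j) / Δt
        - μ * ((G.dxEx (Wx n) i j - G.dxEx (Wx n) (i - 1) j) / G.hc i)
        - μ * ((G.DyEx (Wx n) i (j + 1) - G.DyEx (Wx n) i j) / G.kk j)
        + G.DxC (Z n) i j = fx n i j) ∧
  (∀ n : ℕ, 1 ≤ n →
    ∀ i ∈ Finset.Icc (0 : ℤ) ((G.Nx : ℤ) - 1), ∀ j ∈ Finset.Icc (1 : ℤ) ((G.Ny : ℤ) - 1),
      (Wy n i j - Wy (n - 1) i j) / Δt
        - μ * ((G.DxEy (Wy n) (i + 1) j - G.DxEy (Wy n) i j) / G.hh i)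
        - μ * ((G.dyEy (Wy n) i j - G.dyEy (Wy n) i (j - 1)) / G.kc j)
        + G.DyC (Z n) i j = fy n i j) ∧
  (∀ n : ℕ, 1 ≤ n →
    ∀ i ∈ Finset.Icc (0 : ℤ) ((G.Nx : ℤ) - 1), ∀ j ∈ Finset.Icc (0 : ℤ) ((G.Ny : ℤ) - 1),
      G.dxEx (Wx n) i j + G.dyEy (Wy n) i j = 0)

/-- The compact-support condition: the discrete solution vanishes within one mesh
layer of `∂Ω`. -/
def CompactSupp (Wx Wy Z : ℕ → ℤ → ℤ → ℝ) : Prop :=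
  (∀ n : ℕ, ∀ j : ℤ,
    Wx n 0 j = 0 ∧ Wx n 1 j = 0 ∧ Wx n ((G.Nx : ℤ) - 1) j = 0 ∧ Wx n (G.Nx : ℤ) j = 0) ∧
  (∀ n : ℕ, ∀ i : ℤ,
    Wx n i (-1) = 0 ∧ Wx n i 0 = 0 ∧ Wx n i ((G.Ny : ℤ) - 1) = 0 ∧ Wx n i (G.Ny : ℤ) = 0) ∧
  (∀ n : ℕ, ∀ j : ℤ,
    Wy n (-1) j = 0 ∧ Wy n 0 j = 0 ∧ Wy n ((G.Nx : ℤ) - 1) j = 0 ∧ Wy n (G.Nx : ℤ) j = 0) ∧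
  (∀ n : ℕ, ∀ i : ℤ,
    Wy n i 0 = 0 ∧ Wy n i 1 = 0 ∧ Wy n i ((G.Ny : ℤ) - 1) = 0 ∧ Wy n i (G.Ny : ℤ) = 0) ∧
  (∀ n : ℕ, ∀ j : ℤ, Z n 0 j = 0) ∧
  (∀ n : ℕ, ∀ i : ℤ, Z n i 0 = 0)

/-! ### Auxiliary interpolants and consistency functions -/

/-- The auxiliary interpolant `ũ^{x,n}_{i,j+1/2}`, with its boundary extension. -/
def tux (ux : ℝ → ℝ → ℝ → ℝ) (Δt : ℝ) (n : ℕ) (i j : ℤ) : ℝ :=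
  if j = -1 then ux (G.xp i) (G.yp 0) ((n : ℝ) * Δt)
  else if j = (G.Ny : ℤ) then ux (G.xp i) (G.yp (G.Ny : ℤ)) ((n : ℝ) * Δt)
  else (1 / G.kk j) * (∫ y in (G.yp j)..(G.yp (j + 1)), ux (G.xp i) y ((n : ℝ) * Δt))
    - (G.kk j) ^ 2 / 6 * pdy (pdy ux) (G.xp i) (G.yh j) ((n : ℝ) * Δt)

/-- The auxiliary interpolant `ũ^{y,n}_{i+1/2,j}`, with its boundary extension. -/
def tuy (uy : ℝ → ℝ → ℝ → ℝ) (Δt : ℝ) (n : ℕ) (i j : ℤ) : ℝ :=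
  if i = -1 then uy (G.xp 0) (G.yp j) ((n : ℝ) * Δt)
  else if i = (G.Nx : ℤ) then uy (G.xp (G.Nx : ℤ)) (G.yp j) ((n : ℝ) * Δt)
  else (1 / G.hh i) * (∫ x in (G.xp i)..(G.xp (i + 1)), uy x (G.yp j) ((n : ℝ) * Δt))
    - (G.hh i) ^ 2 / 6 * pdx (pdx uy) (G.xh i) (G.yp j) ((n : ℝ) * Δt)

/-- `γ^{x,n}_{i+1/2,j+1/2} = (h_{i+1/2}²/8) ∂²u^x/∂t∂x (x_{i+1/2}, y_{j+1/2}, t^n)`. -/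
def gammax (ux : ℝ → ℝ → ℝ → ℝ) (Δt : ℝ) (n : ℕ) (i j : ℤ) : ℝ :=
  (G.hh i) ^ 2 / 8 * pdt (pdx ux) (G.xh i) (G.yh j) ((n : ℝ) * Δt)

/-- `γ^{y,n}_{i+1/2,j+1/2} = (k_{j+1/2}²/8) ∂²u^y/∂t∂y (x_{i+1/2}, y_{j+1/2}, t^n)`. -/
def gammay (uy : ℝ → ℝ → ℝ → ℝ) (Δt : ℝ) (n : ℕ) (i j : ℤ) : ℝ :=
  (G.kk j) ^ 2 / 8 * pdt (pdy uy) (G.xh i) (G.yh j) ((n : ℝ) * Δt)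

end Grid

/-! ### Averaging (interpolation) operators on a uniform grid -/

/-- `P^x_h` : x-edge function → cell-centered function. -/
def PxEx (f : ℤ → ℤ → ℝ) (i j : ℤ) : ℝ := (f i j + f (i + 1) j) / 2

/-- `P^x_h` : cell-centered function → x-edge function. -/
def PxC (q : ℤ → ℤ → ℝ) (i j : ℤ) : ℝ := (q (i - 1) j + q i j) / 2

/-- `P^x_h` : y-edge function → node function. -/
def PxEyN (f : ℤ → ℤ → ℝ) (i j : ℤ) : ℝ := (f (i - 1) j + f i j) / 2

/-- `P^x_h` : node function → y-edge function. -/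
def PxN (g : ℤ → ℤ → ℝ) (i j : ℤ) : ℝ := (g i j + g (i + 1) j) / 2

/-- `P^y_h` : y-edge function → cell-centered function. -/
def PyEy (f : ℤ → ℤ → ℝ) (i j : ℤ) : ℝ := (f i j + f i (j + 1)) / 2

/-- `P^y_h` : cell-centered function → y-edge function. -/
def PyC (q : ℤ → ℤ → ℝ) (i j : ℤ) : ℝ := (q i (j - 1) + q i j) / 2

/-- `P^y_h` : x-edge function → node function. -/
def PyEx (f : ℤ → ℤ → ℝ) (i j : ℤ) : ℝ := (f i (j - 1) + f i j) / 2

/-- `P^y_h` : node function → x-edge function. -/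
def PyN (g : ℤ → ℤ → ℝ) (i j : ℤ) : ℝ := (g i j + g i (j + 1)) / 2

namespace Grid

variable (G : Grid)

/-- The discrete nonlinear term `α^{x,n}_{i,j+1/2}` of the fully implicit RMAC scheme. -/
def alphaX (Wx Wy : ℤ → ℤ → ℝ) (i j : ℤ) : ℝ :=
  (Wx i j * G.DxC (PxEx Wx) i j
    + PxC (G.dxEx fun a b => (Wx a b) ^ 2) i j
    + PyN (fun a b => PxEyN Wy a b * G.DyEx Wx a b) i j
    + (PyEx Wx i (j + 1) * PxEyN Wy i (j + 1) - PyEx Wx i j * PxEyN Wy i j) / G.kk j) / 2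

/-- The discrete nonlinear term `α^{y,n}_{i+1/2,j}` of the fully implicit RMAC scheme. -/
def alphaY (Wx Wy : ℤ → ℤ → ℝ) (i j : ℤ) : ℝ :=
  (Wy i j * G.DyC (PyEy Wy) i j
    + PyC (G.dyEy fun a b => (Wy a b) ^ 2) i j
    + PxN (fun a b => PyEx Wx a b * G.DxEy Wy a b) i j
    + (PyEx Wx (i + 1) j * PxEyN Wy (i + 1) j - PyEx Wx i j * PxEyN Wy i j) / G.hh i) / 2

/-- The fully implicit RMAC scheme for the Navier–Stokes equations. -/
def IsRMACNS (μ Δt : ℝ) (fx fy Wx Wy Z : ℕ → ℤ → ℤ → ℝ) : Prop :=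
  (∀ n : ℕ, ∀ j : ℤ, Wx n 0 j = 0 ∧ Wx n (G.Nx : ℤ) j = 0) ∧
  (∀ n : ℕ, ∀ i : ℤ, Wx n i (-1) = 0 ∧ Wx n i (G.Ny : ℤ) = 0) ∧
  (∀ n : ℕ, ∀ i : ℤ, Wy n i 0 = 0 ∧ Wy n i (G.Ny : ℤ) = 0) ∧
  (∀ n : ℕ, ∀ j : ℤ, Wy n (-1) j = 0 ∧ Wy n (G.Nx : ℤ) j = 0) ∧
  (∀ i j : ℤ, Wx 0 i j = 0 ∧ Wy 0 i j = 0) ∧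
  (∀ n : ℕ, 1 ≤ n →
    ∀ i ∈ Finset.Icc (1 : ℤ) ((G.Nx : ℤ) - 1), ∀ j ∈ Finset.Icc (0 : ℤ) ((G.Ny : ℤ) - 1),
      (Wx n i j - Wx (n - 1) i j) / Δt
        - μ * ((G.dxEx (Wx n) i j - G.dxEx (Wx n) (i - 1) j) / G.hc i)
        - μ * ((G.DyEx (Wx n) i (j + 1) - G.DyEx (Wx n) i j) / G.kk j)
        + G.alphaX (Wx n) (Wy n) i j
        + G.DxC (Z n) i j = fx n i j) ∧
  (∀ n : ℕ, 1 ≤ n →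
    ∀ i ∈ Finset.Icc (0 : ℤ) ((G.Nx : ℤ) - 1), ∀ j ∈ Finset.Icc (1 : ℤ) ((G.Ny : ℤ) - 1),
      (Wy n i j - Wy (n - 1) i j) / Δt
        - μ * ((G.DxEy (Wy n) (i + 1) j - G.DxEy (Wy n) i j) / G.hh i)
        - μ * ((G.dyEy (Wy n) i j - G.dyEy (Wy n) i (j - 1)) / G.kc j)
        + G.alphaY (Wx n) (Wy n) i j
        + G.DyC (Z n) i j = fy n i j) ∧
  (∀ n : ℕ, 1 ≤ n →
    ∀ i ∈ Finset.Icc (0 : ℤ) ((G.Nx : ℤ) - 1), ∀ j ∈ Finset.Icc (0 : ℤ) ((G.Ny : ℤ) - 1),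
      G.dxEx (Wx n) i j + G.dyEy (Wy n) i j = 0)

/-- A uniform grid with mesh sizes `h` (in x) and `k` (in y). -/
def Uniform (h k : ℝ) : Prop :=
  (∀ i : ℤ, 0 ≤ i → i < G.Nx → G.hh i = h) ∧ (∀ j : ℤ, 0 ≤ j → j < G.Ny → G.kk j = k)

end Grid

end RMAC

open RMAC

namespace RMAC

/-! ### One-dimensional Taylor estimates -/

lemma abs_le_mul_of_hasDerivAt {f f' : ℝ → ℝ} {C S : ℝ} {n : ℕ} (hC : 0 ≤ C)
    (hf : ∀ s, HasDerivAt f (f' s) s) (h0 : f 0 = 0)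
    (hb : ∀ s ∈ Set.Icc 0 S, |f' s| ≤ C * s ^ n) :
    ∀ s ∈ Set.Icc 0 S, |f s| ≤ C * s ^ (n + 1) := by
  intro s hs
  have key := norm_image_sub_le_of_norm_deriv_le_segment' (f := f) (f' := f') (a := 0) (b := s)
    (C := C * s ^ n) (fun x _ => (hf x).hasDerivWithinAt)
    (fun x hx => (hb x ⟨hx.1, hx.2.le.trans hs.2⟩).trans
      (mul_le_mul_of_nonneg_left (pow_le_pow_left₀ hx.1 hx.2.le n) hC)) s ⟨hs.1, le_rfl⟩
  rw [h0, sub_zero, sub_zero, Real.norm_eq_abs] at key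
  rwa [pow_succ, ← mul_assoc]

lemma abs_sub_le_of_hasDerivAt {f f' : ℝ → ℝ} {a b K x y : ℝ}
    (hf : ∀ s, HasDerivAt f (f' s) s) (hb : ∀ s ∈ Set.Icc a b, |f' s| ≤ K)
    (hx : x ∈ Set.Icc a b) (hy : y ∈ Set.Icc a b) : |f x - f y| ≤ K * |x - y| :=
  (convex_Icc a b).norm_image_sub_le_of_norm_hasDerivWithin_le
    (fun s _ => (hf s).hasDerivWithinAt) hb hy hx

/-- Central difference with third-derivative remainder. -/
lemma abs_central_diff_le {g g₁ g₂ g₃ : ℝ → ℝ} {m S K : ℝ} (hS : 0 ≤ S)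
    (h₁ : ∀ s, HasDerivAt g (g₁ s) s) (h₂ : ∀ s, HasDerivAt g₁ (g₂ s) s)
    (h₃ : ∀ s, HasDerivAt g₂ (g₃ s) s) (hK : ∀ s ∈ Set.Icc (m - S) (m + S), |g₃ s| ≤ K) :
    |g (m + S) - g (m - S) - 2 * S * g₁ m| ≤ 2 * K * S ^ 3 := by
  have hK0 : 0 ≤ K := (abs_nonneg _).trans (hK m ⟨by linarith, by linarith⟩)
  have hp : ∀ s : ℝ, HasDerivAt (fun s => m + s) 1 s := fun s => (hasDerivAt_id s).const_add m
  have hm : ∀ s : ℝ, HasDerivAt (fun s => m - s) (-1) s := fun s => (hasDerivAt_id s).const_sub m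
  have b₂ : ∀ s ∈ Set.Icc 0 S, |g₂ (m + s) - g₂ (m - s)| ≤ 2 * K * s ^ 1 := by
    intro s hs
    have := abs_sub_le_of_hasDerivAt h₃ hK (x := m + s) (y := m - s)
      ⟨by linarith [hs.1, hs.2], by linarith [hs.1, hs.2]⟩
      ⟨by linarith [hs.1, hs.2], by linarith [hs.1, hs.2]⟩
    rw [show m + s - (m - s) = 2 * s by ring, abs_of_nonneg (mul_nonneg zero_le_two hs.1)] at this
    linarith
  have b₁ := abs_le_mul_of_hasDerivAt (f := fun s => g₁ (m + s) + g₁ (m - s) - 2 * g₁ m)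
    (f' := fun s => g₂ (m + s) - g₂ (m - s)) (by positivity)
    (fun s => (((HasDerivAt.comp s (h₂ _) (hp s)).add
      (HasDerivAt.comp s (h₂ _) (hm s))).sub_const _).congr_deriv (by ring))
    (by simp; ring) b₂
  have b₀ := abs_le_mul_of_hasDerivAt (f := fun s => g (m + s) - g (m - s) - s * (2 * g₁ m))
    (f' := fun s => g₁ (m + s) + g₁ (m - s) - 2 * g₁ m) (by positivity)
    (fun s => (((HasDerivAt.comp s (h₁ _) (hp s)).sub
      (HasDerivAt.comp s (h₁ _) (hm s))).sub
        ((hasDerivAt_id s).mul_const _)).congr_deriv (by ring))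
    (by simp) b₁ S ⟨hS, le_rfl⟩
  convert b₀ using 2
  ring

/-- Central difference with fourth-derivative remainder. -/
lemma abs_central_diff_sub_cubic_le {g g₁ g₂ g₃ g₄ : ℝ → ℝ} {m S K : ℝ} (hS : 0 ≤ S)
    (h₁ : ∀ s, HasDerivAt g (g₁ s) s) (h₂ : ∀ s, HasDerivAt g₁ (g₂ s) s)
    (h₃ : ∀ s, HasDerivAt g₂ (g₃ s) s) (h₄ : ∀ s, HasDerivAt g₃ (g₄ s) s)
    (hK : ∀ s ∈ Set.Icc (m - S) (m + S), |g₄ s| ≤ K) :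
    |g (m + S) - g (m - S) - 2 * S * g₁ m - S ^ 3 / 3 * g₃ m| ≤ K * S ^ 3 * (2 * S) := by
  have hK0 : 0 ≤ K := (abs_nonneg _).trans (hK m ⟨by linarith, by linarith⟩)
  set G : ℝ → ℝ := fun s => g s - (s - m) ^ 3 / 6 * g₃ m
  set G₁ : ℝ → ℝ := fun s => g₁ s - (s - m) ^ 2 / 2 * g₃ m
  set G₂ : ℝ → ℝ := fun s => g₂ s - (s - m) * g₃ m
  set G₃ : ℝ → ℝ := fun s => g₃ s - g₃ m
  have hi : ∀ s : ℝ, HasDerivAt (fun s => s - m) 1 s := fun s => (hasDerivAt_id s).sub_const m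
  have := abs_central_diff_le (g := G) (g₁ := G₁) (g₂ := G₂) (g₃ := G₃) (m := m) (K := K * S) hS
    (fun s => ((h₁ s).sub ((((hi s).pow 3).div_const 6).mul_const _)).congr_deriv
      (by simp only [G₁]; ring))
    (fun s => ((h₂ s).sub ((((hi s).pow 2).div_const 2).mul_const _)).congr_deriv
      (by simp only [G₂]; ring))
    (fun s => ((h₃ s).sub ((hi s).mul_const _)).congr_deriv (by simp [G₃]))
    (fun s hs => (abs_sub_le_of_hasDerivAt h₄ hK hs
      ⟨by linarith, by linarith⟩).trans (mul_le_mul_of_nonneg_left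
        (abs_le.2 ⟨by linarith [hs.1], by linarith [hs.2]⟩) hK0))
  simp only [G, G₁] at this
  convert this using 1
  · congr 1
    ring
  · ring

/-- The jump at `a₁` of the slopes of the piecewise linear interpolant of `f` at
`a₀`, `a₁`, `a₂`. -/
def slopeJump (a₀ a₁ a₂ : ℝ) (f : ℝ → ℝ) : ℝ :=
  (f a₂ - f a₁) / (a₂ - a₁) - (f a₁ - f a₀) / (a₁ - a₀)

lemma abs_slopeJump_le {f f₁ f₂ : ℝ → ℝ} {a₀ a₁ a₂ K : ℝ} (h₀₁ : a₀ < a₁) (h₁₂ : a₁ < a₂)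
    (hf : ∀ s, HasDerivAt f (f₁ s) s) (hf₁ : ∀ s, HasDerivAt f₁ (f₂ s) s)
    (hK : ∀ s ∈ Set.Icc a₀ a₂, |f₂ s| ≤ K) : |slopeJump a₀ a₁ a₂ f| ≤ K * (a₂ - a₀) := by
  have hK0 : 0 ≤ K := (abs_nonneg _).trans (hK a₁ ⟨h₀₁.le, h₁₂.le⟩)
  have hc : Continuous f := continuous_iff_continuousAt.2 fun s => (hf s).continuousAt
  obtain ⟨c, hc₁, e₁⟩ := exists_hasDerivAt_eq_slope f f₁ h₀₁ hc.continuousOn fun s _ => hf s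
  obtain ⟨d, hd₁, e₂⟩ := exists_hasDerivAt_eq_slope f f₁ h₁₂ hc.continuousOn fun s _ => hf s
  rw [slopeJump, ← e₁, ← e₂]
  refine (abs_sub_le_of_hasDerivAt hf₁ hK ⟨by linarith [hd₁.1], hd₁.2.le⟩
    ⟨hc₁.1.le, by linarith [hc₁.2]⟩).trans (mul_le_mul_of_nonneg_left ?_ hK0)
  exact abs_le.2 ⟨by linarith [hd₁.1, hc₁.2], by linarith [hd₁.2, hc₁.1]⟩

/-- Midpoint rule for averages. -/
lemma abs_average_sub_midpoint_le {F F₁ F₂ : ℝ → ℝ} {b₀ b₁ K : ℝ} (hb : b₀ < b₁)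
    (h₁ : ∀ s, HasDerivAt F (F₁ s) s) (h₂ : ∀ s, HasDerivAt F₁ (F₂ s) s)
    (hK : ∀ s ∈ Set.Icc b₀ b₁, |F₂ s| ≤ K) :
    |1 / (b₁ - b₀) * (∫ r in b₀..b₁, F r) - F ((b₀ + b₁) / 2)| ≤ K * (b₁ - b₀) ^ 2 / 4 := by
  have hF : Continuous F := continuous_iff_continuousAt.2 fun s => (h₁ s).continuousAt
  have hd : 0 < b₁ - b₀ := sub_pos.2 hb
  have key := abs_central_diff_le (g := fun u => ∫ r in b₀..u, F r) (m := (b₀ + b₁) / 2)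
    (S := (b₁ - b₀) / 2) (K := K) (by linarith)
    (fun s => intervalIntegral.integral_hasDerivAt_right (hF.intervalIntegrable _ _)
      hF.stronglyMeasurable.stronglyMeasurableAtFilter hF.continuousAt) h₁ h₂
    (fun s hs => hK s ⟨by linarith [hs.1], by linarith [hs.2]⟩)
  rw [show (b₀ + b₁) / 2 + (b₁ - b₀) / 2 = b₁ by ring,
    show (b₀ + b₁) / 2 - (b₁ - b₀) / 2 = b₀ by ring, intervalIntegral.integral_same] at key
  rw [show 1 / (b₁ - b₀) * (∫ r in b₀..b₁, F r) - F ((b₀ + b₁) / 2) =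
    ((∫ r in b₀..b₁, F r) - 0 - 2 * ((b₁ - b₀) / 2) * F ((b₀ + b₁) / 2)) / (b₁ - b₀) by
      field_simp; ring, abs_div, abs_of_pos hd, div_le_iff₀ hd]
  refine key.trans (le_of_eq ?_)
  ring

/-- The difference quotient over `[a, b]` in terms of derivatives at the midpoint. -/
lemma abs_slope_sub_midpoint_le {g g₁ g₂ g₃ g₄ : ℝ → ℝ} {a b K : ℝ} (hab : a < b)
    (h₁ : ∀ s, HasDerivAt g (g₁ s) s) (h₂ : ∀ s, HasDerivAt g₁ (g₂ s) s)
    (h₃ : ∀ s, HasDerivAt g₂ (g₃ s) s) (h₄ : ∀ s, HasDerivAt g₃ (g₄ s) s)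
    (hK : ∀ s ∈ Set.Icc a b, |g₄ s| ≤ K) :
    |(g b - g a) / (b - a) - g₁ ((a + b) / 2) - (b - a) ^ 2 / 24 * g₃ ((a + b) / 2)| ≤
      K * (b - a) ^ 3 / 8 := by
  have hd : 0 < b - a := sub_pos.2 hab
  have key := abs_central_diff_sub_cubic_le (m := (a + b) / 2) (S := (b - a) / 2) (K := K)
    (by linarith) h₁ h₂ h₃ h₄ (fun s hs => hK s ⟨by linarith [hs.1], by linarith [hs.2]⟩)
  rw [show (a + b) / 2 + (b - a) / 2 = b by ring,
    show (a + b) / 2 - (b - a) / 2 = a by ring] at key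
  rw [show (g b - g a) / (b - a) - g₁ ((a + b) / 2) - (b - a) ^ 2 / 24 * g₃ ((a + b) / 2) =
    (g b - g a - 2 * ((b - a) / 2) * g₁ ((a + b) / 2) -
      ((b - a) / 2) ^ 3 / 3 * g₃ ((a + b) / 2)) / (b - a) by field_simp; ring,
    abs_div, abs_of_pos hd, div_le_iff₀ hd]
  refine key.trans (le_of_eq ?_)
  ring

/-! ### The planar estimate -/

/-- The corrected transverse average of `u (s, ·)` over `[b₀, b₁]`, where `w` plays the role of
the second transverse derivative of `u`. -/
def correctedAverage (u w : ℝ → ℝ → ℝ) (b₀ b₁ s : ℝ) : ℝ :=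
  1 / (b₁ - b₀) * (∫ r in b₀..b₁, u s r) - (b₁ - b₀) ^ 2 / 6 * w s ((b₀ + b₁) / 2)

lemma slopeJump_correctedAverage {u w : ℝ → ℝ → ℝ} (hu : ∀ s, Continuous (u s))
    (a₀ a₁ a₂ b₀ b₁ : ℝ) :
    slopeJump a₀ a₁ a₂ (correctedAverage u w b₀ b₁) =
      1 / (b₁ - b₀) * (∫ r in b₀..b₁, slopeJump a₀ a₁ a₂ fun s => u s r) -
        (b₁ - b₀) ^ 2 / 6 * slopeJump a₀ a₁ a₂ fun s => w s ((b₀ + b₁) / 2) := by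
  have hi : ∀ s, IntervalIntegrable (u s) volume b₀ b₁ := fun s => (hu s).intervalIntegrable _ _
  simp only [slopeJump, correctedAverage]
  rw [intervalIntegral.integral_sub (((hi _).sub (hi _)).div_const _)
    (((hi _).sub (hi _)).div_const _), intervalIntegral.integral_div,
    intervalIntegral.integral_div, intervalIntegral.integral_sub (hi _) (hi _),
    intervalIntegral.integral_sub (hi _) (hi _)]
  ring

/-- Second-difference consistency on two adjacent cells `[a₀, a₁] × [b₀, b₁]` and
`[a₁, a₂] × [b₀, b₁]`; here `v, w` are the first two transverse derivatives of `u`, while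
`w₁, w₂` are the derivatives of `w`, and `g₁, …, g₄` those of `u (·, (b₀ + b₁) / 2)`, in the flow
direction. -/
lemma abs_second_difference_sub_le {a₀ a₁ a₂ b₀ b₁ h k M : ℝ} {u v w w₁ w₂ : ℝ → ℝ → ℝ}
    {g₁ g₂ g₃ g₄ : ℝ → ℝ} (h₀₁ : a₀ < a₁) (h₁₂ : a₁ < a₂) (hb : b₀ < b₁)
    (hh₀ : a₁ - a₀ ≤ h) (hh₁ : a₂ - a₁ ≤ h) (hk : b₁ - b₀ ≤ k)
    (hv : ∀ s r, HasDerivAt (fun r => u s r) (v s r) r)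
    (hw : ∀ s r, HasDerivAt (fun r => v s r) (w s r) r)
    (hw₁ : ∀ s r, HasDerivAt (fun s => w s r) (w₁ s r) s)
    (hw₂ : ∀ s r, HasDerivAt (fun s => w₁ s r) (w₂ s r) s)
    (hg₁ : ∀ s, HasDerivAt (fun s => u s ((b₀ + b₁) / 2)) (g₁ s) s)
    (hg₂ : ∀ s, HasDerivAt g₁ (g₂ s) s) (hg₃ : ∀ s, HasDerivAt g₂ (g₃ s) s)
    (hg₄ : ∀ s, HasDerivAt g₃ (g₄ s) s)
    (hMw : ∀ s ∈ Set.Icc a₀ a₂, ∀ r ∈ Set.Icc b₀ b₁, |w₂ s r| ≤ M)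
    (hMg : ∀ s ∈ Set.Icc a₀ a₂, |g₄ s| ≤ M) :
    |slopeJump a₀ a₁ a₂ (correctedAverage u w b₀ b₁) / ((a₁ - a₀ + (a₂ - a₁)) / 2)
        - 1 / ((a₁ - a₀ + (a₂ - a₁)) / 2) *
          (∫ s in ((a₀ + a₁) / 2)..((a₁ + a₂) / 2), g₂ s)
        - (((a₂ - a₁) ^ 2 / 24 * g₃ ((a₁ + a₂) / 2)
              - (b₁ - b₀) ^ 2 / 8 * w₁ ((a₁ + a₂) / 2) ((b₀ + b₁) / 2))
            - ((a₁ - a₀) ^ 2 / 24 * g₃ ((a₀ + a₁) / 2)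
              - (b₁ - b₀) ^ 2 / 8 * w₁ ((a₀ + a₁) / 2) ((b₀ + b₁) / 2)))
          / ((a₁ - a₀ + (a₂ - a₁)) / 2)| ≤ M * (h ^ 2 + k ^ 2) := by
  have hmem : (b₀ + b₁) / 2 ∈ Set.Icc b₀ b₁ := ⟨by linarith, by linarith⟩
  have hM : 0 ≤ M := (abs_nonneg _).trans (hMg a₁ ⟨h₀₁.le, h₁₂.le⟩)
  have hc : 0 < (a₁ - a₀ + (a₂ - a₁)) / 2 := by linarith
  have hu : ∀ s, Continuous (u s) := fun s =>
    continuous_iff_continuousAt.2 fun r => (hv s r).continuousAt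
  have hg₂c : Continuous g₂ := continuous_iff_continuousAt.2 fun s => (hg₃ s).continuousAt
  have hjw : ∀ r ∈ Set.Icc b₀ b₁, |slopeJump a₀ a₁ a₂ fun s => w s r| ≤ M * (a₂ - a₀) :=
    fun r hr => abs_slopeJump_le h₀₁ h₁₂ (fun s => hw₁ s r) (fun s => hw₂ s r)
      fun s hs => hMw s hs r hr
  have hav := abs_average_sub_midpoint_le hb
    (F := fun r => slopeJump a₀ a₁ a₂ fun s => u s r)
    (F₁ := fun r => slopeJump a₀ a₁ a₂ fun s => v s r)
    (F₂ := fun r => slopeJump a₀ a₁ a₂ fun s => w s r)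
    (fun r => (((hv _ r).sub (hv _ r)).div_const _).sub (((hv _ r).sub (hv _ r)).div_const _))
    (fun r => (((hw _ r).sub (hw _ r)).div_const _).sub (((hw _ r).sub (hw _ r)).div_const _))
    hjw
  have hr := abs_slope_sub_midpoint_le h₁₂ hg₁ hg₂ hg₃ hg₄
    fun s hs => hMg s ⟨h₀₁.le.trans hs.1, hs.2⟩
  have hl := abs_slope_sub_midpoint_le h₀₁ hg₁ hg₂ hg₃ hg₄
    fun s hs => hMg s ⟨hs.1, hs.2.trans h₁₂.le⟩
  have hjm := hjw _ hmem
  have hw₁d := abs_sub_le_of_hasDerivAt (fun s => hw₂ s ((b₀ + b₁) / 2))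
    (fun s hs => hMw s hs _ hmem) (x := (a₁ + a₂) / 2) (y := (a₀ + a₁) / 2)
    ⟨by linarith, by linarith⟩ ⟨by linarith, by linarith⟩
  rw [show (a₁ + a₂) / 2 - (a₀ + a₁) / 2 = (a₂ - a₀) / 2 by ring,
    abs_of_pos (by linarith : 0 < (a₂ - a₀) / 2)] at hw₁d
  rw [intervalIntegral.integral_eq_sub_of_hasDerivAt (fun s _ => hg₂ s)
    (hg₂c.intervalIntegrable _ _), one_div_mul_eq_div, ← sub_div, ← sub_div, abs_div,
    abs_of_pos hc, div_le_iff₀ hc, slopeJump_correctedAverage hu]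
  set jm := slopeJump a₀ a₁ a₂ fun s => w s ((b₀ + b₁) / 2)
  set av := 1 / (b₁ - b₀) * (∫ r in b₀..b₁, slopeJump a₀ a₁ a₂ fun s => u s r)
  simp only [slopeJump] at hav
  set r₂ := (u a₂ ((b₀ + b₁) / 2) - u a₁ ((b₀ + b₁) / 2)) / (a₂ - a₁)
  set r₁ := (u a₁ ((b₀ + b₁) / 2) - u a₀ ((b₀ + b₁) / 2)) / (a₁ - a₀)
  set dw := w₁ ((a₁ + a₂) / 2) ((b₀ + b₁) / 2) - w₁ ((a₀ + a₁) / 2) ((b₀ + b₁) / 2) with hdw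
  have hcube : ∀ d, 0 ≤ d → d ≤ h → M * d ^ 3 / 8 ≤ M * h ^ 2 * d / 8 := fun d hd hdh => by
    have := mul_le_mul_of_nonneg_left (pow_le_pow_left₀ hd hdh 2) (mul_nonneg hM hd)
    linarith
  have c₁ := hcube _ (by linarith) hh₀
  have c₂ := hcube _ (by linarith) hh₁
  have hk2 : (b₁ - b₀) ^ 2 ≤ k ^ 2 := pow_le_pow_left₀ (by linarith) hk 2
  have hB : 0 ≤ M * (a₂ - a₀) := mul_nonneg hM (by linarith)
  have hjm' : |(b₁ - b₀) ^ 2 / 6 * jm| ≤ (b₁ - b₀) ^ 2 / 6 * (M * (a₂ - a₀)) := by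
    rw [abs_mul, abs_of_nonneg (by positivity : 0 ≤ (b₁ - b₀) ^ 2 / 6)]
    gcongr
  have hdw' : |(b₁ - b₀) ^ 2 / 8 * dw| ≤ (b₁ - b₀) ^ 2 / 8 * (M * ((a₂ - a₀) / 2)) := by
    rw [abs_mul, abs_of_nonneg (by positivity : 0 ≤ (b₁ - b₀) ^ 2 / 8)]
    gcongr
  have hBk := mul_le_mul_of_nonneg_left hk2 hB
  have hBh : 0 ≤ M * (a₂ - a₀) * h ^ 2 := by positivity
  have hBb : 0 ≤ M * (a₂ - a₀) * (b₁ - b₀) ^ 2 := by positivity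
  clear_value av jm
  rw [hdw] at hdw'
  rw [abs_le] at hav hjm' hdw' hr hl ⊢
  constructor <;> linarith [hav.1, hav.2, hjm'.1, hjm'.2, hdw'.1, hdw'.2, hr.1, hr.2, hl.1, hl.2]

/-! ### Partial derivatives of smooth functions -/

section Smooth

variable {f : ℝ → ℝ → ℝ → ℝ}

lemma Smooth.differentiableAt (hf : Smooth f) (q : ℝ × ℝ × ℝ) :
    DifferentiableAt ℝ (fun q : ℝ × ℝ × ℝ => f q.1 q.2.1 q.2.2) q :=
  (hf 1).differentiable (by norm_num) q

lemma Smooth.hasDerivAt_fderiv_x (hf : Smooth f) (x y t : ℝ) :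
    HasDerivAt (fun s => f s y t)
      (fderiv ℝ (fun q : ℝ × ℝ × ℝ => f q.1 q.2.1 q.2.2) (x, y, t) (1, 0, 0)) x :=
  HasFDerivAt.comp_hasDerivAt (f := fun s : ℝ => (s, y, t)) x
    (hf.differentiableAt (x, y, t)).hasFDerivAt
    (((hasDerivAt_id x).prodMk ((hasDerivAt_const x y).prodMk (hasDerivAt_const x t))))

lemma Smooth.hasDerivAt_fderiv_y (hf : Smooth f) (x y t : ℝ) :
    HasDerivAt (fun s => f x s t)
      (fderiv ℝ (fun q : ℝ × ℝ × ℝ => f q.1 q.2.1 q.2.2) (x, y, t) (0, 1, 0)) y :=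
  HasFDerivAt.comp_hasDerivAt (f := fun s : ℝ => (x, s, t)) y
    (hf.differentiableAt (x, y, t)).hasFDerivAt
    (((hasDerivAt_const y x).prodMk ((hasDerivAt_id y).prodMk (hasDerivAt_const y t))))

lemma Smooth.pdx_eq (hf : Smooth f) (x y t : ℝ) :
    pdx f x y t = fderiv ℝ (fun q : ℝ × ℝ × ℝ => f q.1 q.2.1 q.2.2) (x, y, t) (1, 0, 0) :=
  (hf.hasDerivAt_fderiv_x x y t).deriv

lemma Smooth.pdy_eq (hf : Smooth f) (x y t : ℝ) :
    pdy f x y t = fderiv ℝ (fun q : ℝ × ℝ × ℝ => f q.1 q.2.1 q.2.2) (x, y, t) (0, 1, 0) :=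
  (hf.hasDerivAt_fderiv_y x y t).deriv

lemma Smooth.hasDerivAt_pdx (hf : Smooth f) (x y t : ℝ) :
    HasDerivAt (fun s => f s y t) (pdx f x y t) x :=
  (hf.hasDerivAt_fderiv_x x y t).differentiableAt.hasDerivAt

lemma Smooth.hasDerivAt_pdy (hf : Smooth f) (x y t : ℝ) :
    HasDerivAt (fun s => f x s t) (pdy f x y t) y :=
  (hf.hasDerivAt_fderiv_y x y t).differentiableAt.hasDerivAt

lemma Smooth.contDiff_fderiv_apply (hf : Smooth f) (e : ℝ × ℝ × ℝ) (n : ℕ) :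
    ContDiff ℝ n fun q => fderiv ℝ (fun q : ℝ × ℝ × ℝ => f q.1 q.2.1 q.2.2) q e :=
  ((hf (n + 1)).fderiv_right (by norm_cast)).clm_apply contDiff_const

lemma Smooth.pdx (hf : Smooth f) : Smooth (pdx f) := fun n => by
  simpa only [hf.pdx_eq] using hf.contDiff_fderiv_apply (1, 0, 0) n

lemma Smooth.pdy (hf : Smooth f) : Smooth (pdy f) := fun n => by
  simpa only [hf.pdy_eq] using hf.contDiff_fderiv_apply (0, 1, 0) n

lemma Smooth.pdy_pdx (hf : Smooth f) : RMAC.pdy (RMAC.pdx f) = RMAC.pdx (RMAC.pdy f) := by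
  funext x y t
  set F : ℝ × ℝ × ℝ → ℝ := fun q => f q.1 q.2.1 q.2.2 with hF
  have hd : DifferentiableAt ℝ (fderiv ℝ F) (x, y, t) :=
    ((hf 2).fderiv_right (m := 1) (by norm_num)).differentiable (by norm_num) _
  have happ : ∀ e e' : ℝ × ℝ × ℝ,
      fderiv ℝ (fun q => fderiv ℝ F q e) (x, y, t) e' = fderiv ℝ (fderiv ℝ F) (x, y, t) e' e :=
    fun e e' => by rw [fderiv_clm_apply hd (differentiableAt_const e)]; simp
  rw [hf.pdx.pdy_eq, hf.pdy.pdx_eq]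
  simp only [hf.pdx_eq, hf.pdy_eq, Prod.mk.eta, ← hF]
  rw [happ, happ]
  exact second_derivative_symmetric (fun q => (hf.differentiableAt q).hasFDerivAt)
    hd.hasFDerivAt _ _

lemma Smooth.pdy_pdx_pdx (hf : Smooth f) :
    RMAC.pdy (RMAC.pdx (RMAC.pdx f)) = RMAC.pdx (RMAC.pdx (RMAC.pdy f)) := by
  rw [hf.pdx.pdy_pdx, hf.pdy_pdx]

end Smooth

/-! ### Grid geometry -/

namespace Grid

variable (G : Grid)

lemma mem_Icc_of_mono {p : ℤ → ℝ} {N : ℕ} (hp : ∀ i : ℤ, 0 ≤ i → i < N → p i < p (i + 1))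
    {i : ℤ} (h0 : 0 ≤ i) (hN : i ≤ N) : p i ∈ Set.Icc (p 0) (p N) := by
  have hmono : ∀ a : ℤ, 0 ≤ a → ∀ b : ℤ, a ≤ b → b ≤ N → p a ≤ p b := by
    intro a ha b hab
    induction b, hab using Int.leInduction with
    | base => exact fun _ => le_rfl
    | succ b hab ih => exact fun hb => (ih (by omega)).trans (hp b (by omega) (by omega)).le
  exact ⟨hmono 0 le_rfl i h0 hN, hmono i h0 N hN le_rfl⟩

lemma xp_mem {i : ℤ} (h0 : 0 ≤ i) (hN : i ≤ G.Nx) : G.xp i ∈ Set.Icc 0 G.Lx := by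
  simpa only [G.xp_zero, G.xp_last] using mem_Icc_of_mono G.xp_mono h0 hN

lemma yp_mem {j : ℤ} (h0 : 0 ≤ j) (hN : j ≤ G.Ny) : G.yp j ∈ Set.Icc 0 G.Ly := by
  simpa only [G.yp_zero, G.yp_last] using mem_Icc_of_mono G.yp_mono h0 hN

lemma hh_le_hmax {i : ℤ} (h0 : 0 ≤ i) (hN : i < G.Nx) : G.hh i ≤ G.hmax :=
  Finset.le_sup' G.hh (Finset.mem_Icc.2 ⟨h0, by omega⟩)

lemma kk_le_kmax {j : ℤ} (h0 : 0 ≤ j) (hN : j < G.Ny) : G.kk j ≤ G.kmax :=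
  Finset.le_sup' G.kk (Finset.mem_Icc.2 ⟨h0, by omega⟩)

lemma tux_eq_correctedAverage (ux : ℝ → ℝ → ℝ → ℝ) (Δt : ℝ) (n : ℕ) (i : ℤ) {j : ℤ}
    (h0 : 0 ≤ j) (hN : j < G.Ny) :
    G.tux ux Δt n i j = correctedAverage (fun s r => ux s r (n * Δt))
      (fun s r => pdy (pdy ux) s r (n * Δt)) (G.yp j) (G.yp (j + 1)) (G.xp i) := by
  rw [tux, if_neg (by omega), if_neg (by omega)]
  rfl

lemma tuy_eq_correctedAverage (uy : ℝ → ℝ → ℝ → ℝ) (Δt : ℝ) (n : ℕ) {i : ℤ} (j : ℤ)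
    (h0 : 0 ≤ i) (hN : i < G.Nx) :
    G.tuy uy Δt n i j = correctedAverage (fun s r => uy r s (n * Δt))
      (fun s r => pdx (pdx uy) r s (n * Δt)) (G.xp i) (G.xp (i + 1)) (G.yp j) := by
  rw [tuy, if_neg (by omega), if_neg (by omega)]
  rfl

lemma hc_interior {i : ℤ} (h0 : 1 ≤ i) (hN : i < G.Nx) : G.hc i = (G.hh (i - 1) + G.hh i) / 2 := by
  rw [hc, if_neg (by omega), if_neg (by omega)]

lemma kc_interior {j : ℤ} (h0 : 1 ≤ j) (hN : j < G.Ny) : G.kc j = (G.kk (j - 1) + G.kk j) / 2 := by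
  rw [kc, if_neg (by omega), if_neg (by omega)]

end Grid

end RMAC

/-- second-difference consistency of the auxiliary interpolants in the
flow direction. The second difference quotient of `ũ^x` in `x` equals the cell average of
`∂²u^x/∂x²` plus the difference quotient of the `ε^{x,x}` terms, up to
`O(‖u‖_{L^∞W^{4,∞}}(h²+k²))`, and symmetrically in the y-direction. -/
theorem second_difference_consistency (Lx Ly : ℝ) (hLx : 0 < Lx) (hLy : 0 < Ly) :
    ∃ C : ℝ, 0 < C ∧
      ∀ T : ℝ, 0 < T → ∀ N : ℕ, 1 ≤ N → ∀ Δt : ℝ, Δt = T / N →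
      ∀ G : RMAC.Grid, G.Lx = Lx → G.Ly = Ly →
      ∀ ux uy : ℝ → ℝ → ℝ → ℝ, RMAC.Smooth ux → RMAC.Smooth uy →
      ∀ M : ℝ, RMAC.SobBound 0 4 ux Lx Ly T M → RMAC.SobBound 0 4 uy Lx Ly T M →
      ∀ εxx εyy : ℕ → ℤ → ℤ → ℝ,
        (εxx = fun (n : ℕ) (i j : ℤ) =>
          (G.hh i) ^ 2 / 24 *
              RMAC.pdx (RMAC.pdx (RMAC.pdx ux)) (G.xh i) (G.yh j) ((n : ℝ) * Δt)
            - (G.kk j) ^ 2 / 8 *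
              RMAC.pdx (RMAC.pdy (RMAC.pdy ux)) (G.xh i) (G.yh j) ((n : ℝ) * Δt)) →
        (εyy = fun (n : ℕ) (i j : ℤ) =>
          -((G.hh i) ^ 2 / 8 *
              RMAC.pdx (RMAC.pdx (RMAC.pdy uy)) (G.xh i) (G.yh j) ((n : ℝ) * Δt))
            + (G.kk j) ^ 2 / 24 *
              RMAC.pdy (RMAC.pdy (RMAC.pdy uy)) (G.xh i) (G.yh j) ((n : ℝ) * Δt)) →
      ∀ n : ℕ, n ≤ N →
        (∀ i ∈ Finset.Icc (1 : ℤ) ((G.Nx : ℤ) - 1),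
          ∀ j ∈ Finset.Icc (0 : ℤ) ((G.Ny : ℤ) - 1),
            |(G.dxEx (G.tux ux Δt n) i j - G.dxEx (G.tux ux Δt n) (i - 1) j) / G.hc i
                - (1 / G.hc i) * (∫ x in (G.xh (i - 1))..(G.xh i),
                    RMAC.pdx (RMAC.pdx ux) x (G.yh j) ((n : ℝ) * Δt))
                - (εxx n i j - εxx n (i - 1) j) / G.hc i| ≤
              C * M * (G.hmax ^ 2 + G.kmax ^ 2)) ∧
        (∀ i ∈ Finset.Icc (0 : ℤ) ((G.Nx : ℤ) - 1),
          ∀ j ∈ Finset.Icc (1 : ℤ) ((G.Ny : ℤ) - 1),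
            |(G.dyEy (G.tuy uy Δt n) i j - G.dyEy (G.tuy uy Δt n) i (j - 1)) / G.kc j
                - (1 / G.kc j) * (∫ y in (G.yh (j - 1))..(G.yh j),
                    RMAC.pdy (RMAC.pdy uy) (G.xh i) y ((n : ℝ) * Δt))
                - (εyy n i j - εyy n i (j - 1)) / G.kc j| ≤
              C * M * (G.hmax ^ 2 + G.kmax ^ 2)) := by
  refine ⟨1, one_pos, ?_⟩
  rintro T hT N hN Δt rfl G rfl rfl ux uy hux huy M hMx hMy _ _ rfl rfl n hn
  have hN0 : (0 : ℝ) < N := by exact_mod_cast hN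
  have ht : (n : ℝ) * (T / N) ∈ Set.Icc 0 T := by
    refine ⟨by positivity, ?_⟩
    rw [mul_div_left_comm]
    exact mul_le_of_le_one_right hT.le ((div_le_one hN0).2 (by exact_mod_cast hn))
  rw [one_mul]
  constructor
  · intro i hi j hj
    rw [Finset.mem_Icc] at hi hj
    obtain ⟨i, rfl⟩ : ∃ l, i = l + 1 := ⟨i - 1, by ring⟩
    have hx : Set.Icc (G.xp i) (G.xp (i + 1 + 1)) ⊆ Set.Icc 0 G.Lx :=
      Set.Icc_subset_Icc (G.xp_mem (by omega) (by omega)).1 (G.xp_mem (by omega) (by omega)).2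
    have hy : Set.Icc (G.yp j) (G.yp (j + 1)) ⊆ Set.Icc 0 G.Ly :=
      Set.Icc_subset_Icc (G.yp_mem (by omega) (by omega)).1 (G.yp_mem (by omega) (by omega)).2
    have hyj := G.yp_mono j (by omega) (by omega)
    have key := abs_second_difference_sub_le (G.xp_mono i (by omega) (by omega))
      (G.xp_mono (i + 1) (by omega) (by omega)) hyj
      (G.hh_le_hmax (i := i) (by omega) (by omega))
      (G.hh_le_hmax (i := i + 1) (by omega) (by omega))
      (G.kk_le_kmax (j := j) (by omega) (by omega))
      (fun s r => hux.hasDerivAt_pdy s r (n * (T / N)))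
      (fun s r => hux.pdy.hasDerivAt_pdy s r _)
      (fun s r => hux.pdy.pdy.hasDerivAt_pdx s r _)
      (fun s r => hux.pdy.pdy.pdx.hasDerivAt_pdx s r _)
      (fun s => hux.hasDerivAt_pdx s _ _)
      (fun s => hux.pdx.hasDerivAt_pdx s _ _)
      (fun s => hux.pdx.pdx.hasDerivAt_pdx s _ _)
      (fun s => hux.pdx.pdx.pdx.hasDerivAt_pdx s _ _)
      (fun s hs r hr => hMx 0 2 2 le_rfl le_rfl s r _ (hx hs) (hy hr) ht)
      (fun s hs => hMx 0 4 0 le_rfl le_rfl s _ _ (hx hs)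
        (hy ⟨by linarith, by linarith⟩) ht)
    rw [G.hc_interior hi.1 (by omega)]
    simp only [Grid.dxEx, G.tux_eq_correctedAverage ux _ n _ hj.1 (show j < G.Ny by omega),
      add_sub_cancel_right]
    exact key
  · intro i hi j hj
    rw [Finset.mem_Icc] at hi hj
    obtain ⟨j, rfl⟩ : ∃ l, j = l + 1 := ⟨j - 1, by ring⟩
    have hx : Set.Icc (G.xp i) (G.xp (i + 1)) ⊆ Set.Icc 0 G.Lx :=
      Set.Icc_subset_Icc (G.xp_mem (by omega) (by omega)).1 (G.xp_mem (by omega) (by omega)).2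
    have hy : Set.Icc (G.yp j) (G.yp (j + 1 + 1)) ⊆ Set.Icc 0 G.Ly :=
      Set.Icc_subset_Icc (G.yp_mem (by omega) (by omega)).1 (G.yp_mem (by omega) (by omega)).2
    have hxi := G.xp_mono i (by omega) (by omega)
    have hmixed : pdy (pdy (pdx (pdx uy))) = pdx (pdx (pdy (pdy uy))) := by
      rw [huy.pdy_pdx_pdx, huy.pdy.pdy_pdx_pdx]
    have key := abs_second_difference_sub_le (G.yp_mono j (by omega) (by omega))
      (G.yp_mono (j + 1) (by omega) (by omega)) hxi
      (G.kk_le_kmax (j := j) (by omega) (by omega))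
      (G.kk_le_kmax (j := j + 1) (by omega) (by omega))
      (G.hh_le_hmax (i := i) (by omega) (by omega))
      (fun s r => huy.hasDerivAt_pdx r s (n * (T / N)))
      (fun s r => huy.pdx.hasDerivAt_pdx r s _)
      (fun s r => huy.pdx.pdx.hasDerivAt_pdy r s _)
      (fun s r => huy.pdx.pdx.pdy.hasDerivAt_pdy r s _)
      (fun s => huy.hasDerivAt_pdy _ s _)
      (fun s => huy.pdy.hasDerivAt_pdy _ s _)
      (fun s => huy.pdy.pdy.hasDerivAt_pdy _ s _)
      (fun s => huy.pdy.pdy.pdy.hasDerivAt_pdy _ s _)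
      (fun s hs r hr => by
        rw [hmixed]
        exact hMy 0 2 2 le_rfl le_rfl r s _ (hx hr) (hy hs) ht)
      (fun s hs => hMy 0 0 4 le_rfl le_rfl _ s _
        (hx ⟨by linarith, by linarith⟩) (hy hs) ht)
    rw [G.kc_interior hj.1 (by omega), add_comm (G.hmax ^ 2)]
    simp only [Grid.dyEy, G.tuy_eq_correctedAverage uy _ n _ hi.1 (show i < G.Nx by omega),
      add_sub_cancel_right, neg_add_eq_sub, ← huy.pdy_pdx_pdx]
    exact key
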